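/- Let σ₁, σ₂, σ₃ be nonzero real numbers with κ̃ := (σ₁+σ₂)(σ₂+σ₃)(σ₃+σ₁) ≠ 0. Then there exist c > 0 and C ≥ 1, depending only on σ₁, σ₂, σ₃, such that for all τ₁, τ₂, τ₃ ∈ ℝ with τ₁+τ₂+τ₃ = 0 and all ξ₁, ξ₂, ξ₃ ∈ ℝ² with ξ₁+ξ₂+ξ₃ = 0: if max_{1≤k≤3} |τ_k + σ_k|ξ_k|²| ≤ c · max_{1≤k≤3} |ξ_k|², then |ξ_i| ≤ C|ξ_j| for all i, j ∈ {1,2,3}, i.e. |ξ₁| ∼ |ξ₂| ∼ |ξ₃|. -/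

import Mathlib

/-- Euclidean norm on ℝ². -/
noncomputable def nrm2 (x : ℝ × ℝ) : ℝ := Real.sqrt (x.1 ^ 2 + x.2 ^ 2)

theorem nrm2_eq_norm (x : ℝ × ℝ) : nrm2 x = ‖(⟨x.1, x.2⟩ : ℂ)‖ := by
  rw [Complex.norm_eq_sqrt_sq_add_sq, nrm2]

theorem nrm2_nonneg (x : ℝ × ℝ) : 0 ≤ nrm2 x := Real.sqrt_nonneg _

theorem nrm2_le_add_of_add_eq_zero {x y z : ℝ × ℝ} (h : x + y + z = 0) :
    nrm2 x ≤ nrm2 y + nrm2 z := by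
  have hx : (⟨x.1, x.2⟩ : ℂ) = -(⟨y.1, y.2⟩ + ⟨z.1, z.2⟩) := by
    have h1 := congrArg Prod.fst h
    have h2 := congrArg Prod.snd h
    simp only [Prod.fst_add, Prod.snd_add, Prod.fst_zero, Prod.snd_zero] at h1 h2
    apply Complex.ext
    · simp only [Complex.neg_re, Complex.add_re]
      linarith
    · simp only [Complex.neg_im, Complex.add_im]
      linarith
  rw [nrm2_eq_norm, nrm2_eq_norm, nrm2_eq_norm, hx, norm_neg]
  exact norm_add_le _ _

/-- If `a` is the largest side of a triangle with sides `a, b, r`, and the quadratic form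
`s a² + t b² + u r²` is small compared to `a²`, then `r` controls `a`, provided `s + t ≠ 0`. -/
theorem mul_largest_side_le {a b r s t u S δ : ℝ} (hb : 0 ≤ b) (hr : 0 ≤ r)
    (hba : b ≤ a) (hra : r ≤ a) (hab : a ≤ b + r) (hst : δ ≤ |s + t|)
    (ht : |t| ≤ S) (hu : |u| ≤ S) (h : |s * a ^ 2 + t * b ^ 2 + u * r ^ 2| ≤ δ / 2 * a ^ 2) :
    δ * a ≤ 6 * S * r := by
  have hS : 0 ≤ S := (abs_nonneg t).trans ht
  have hsq : |t * (a ^ 2 - b ^ 2)| ≤ S * (2 * r * a) := by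
    rw [abs_mul, abs_of_nonneg (by nlinarith : 0 ≤ a ^ 2 - b ^ 2)]
    exact mul_le_mul ht (by nlinarith) (by nlinarith) hS
  have hur : |u * r ^ 2| ≤ S * (r * a) := by
    rw [abs_mul, abs_of_nonneg (sq_nonneg r)]
    exact mul_le_mul hu (by nlinarith) (sq_nonneg r) hS
  have hmain : |s + t| * a ^ 2 ≤ δ / 2 * a ^ 2 + S * (2 * r * a) + S * (r * a) := by
    rw [← abs_of_nonneg (sq_nonneg a), ← abs_mul, abs_of_nonneg (sq_nonneg a)]
    rw [abs_le] at *
    constructor <;> nlinarith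
  have hδa : δ * a ^ 2 ≤ |s + t| * a ^ 2 := mul_le_mul_of_nonneg_right hst (sq_nonneg a)
  rcases (hb.trans hba).eq_or_lt with ha | ha
  · rw [← ha, mul_zero]
    positivity
  · exact le_of_mul_le_mul_right (by linarith) ha

/-- Let σ₁, σ₂, σ₃ be nonzero reals with
κ̃ := (σ₁+σ₂)(σ₂+σ₃)(σ₃+σ₁) ≠ 0. Then there exist c > 0 and C ≥ 1, depending
only on σ₁, σ₂, σ₃, such that for all τ₁,τ₂,τ₃ ∈ ℝ with τ₁+τ₂+τ₃ = 0 and all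
ξ₁,ξ₂,ξ₃ ∈ ℝ² with ξ₁+ξ₂+ξ₃ = 0: if max_k |τ_k + σ_k|ξ_k|²| ≤ c · max_k |ξ_k|²,
then |ξ_i| ≤ C|ξ_j| for all i, j.
(The hypothesis "max_k LHS_k ≤ c · max_m RHS_m" is expressed as
"∀ k, ∃ m, LHS_k ≤ c · RHS_m".) -/
theorem stmt2 (σ : Fin 3 → ℝ) (hσ : ∀ k, σ k ≠ 0)
    (hκ : (σ 0 + σ 1) * (σ 1 + σ 2) * (σ 2 + σ 0) ≠ 0) :
    ∃ c > (0 : ℝ), ∃ C : ℝ, 1 ≤ C ∧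
      ∀ (τ : Fin 3 → ℝ) (ξ : Fin 3 → ℝ × ℝ),
        τ 0 + τ 1 + τ 2 = 0 → ξ 0 + ξ 1 + ξ 2 = 0 →
        (∀ k : Fin 3, ∃ m : Fin 3,
          |τ k + σ k * nrm2 (ξ k) ^ 2| ≤ c * nrm2 (ξ m) ^ 2) →
        ∀ i j : Fin 3, nrm2 (ξ i) ≤ C * nrm2 (ξ j) := by
  obtain ⟨⟨h01, h12⟩, h20⟩ : ((σ 0 + σ 1 ≠ 0) ∧ (σ 1 + σ 2 ≠ 0)) ∧ σ 2 + σ 0 ≠ 0 := by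
    simpa only [mul_ne_zero_iff] using hκ
  obtain ⟨δ, hδ, hδ01, hδ12, hδ20⟩ : ∃ δ > 0,
      δ ≤ |σ 0 + σ 1| ∧ δ ≤ |σ 1 + σ 2| ∧ δ ≤ |σ 2 + σ 0| :=
    ⟨min |σ 0 + σ 1| (min |σ 1 + σ 2| |σ 2 + σ 0|),
      lt_min (abs_pos.2 h01) (lt_min (abs_pos.2 h12) (abs_pos.2 h20)),
      min_le_left _ _, (min_le_right _ _).trans (min_le_left _ _),
      (min_le_right _ _).trans (min_le_right _ _)⟩
  obtain ⟨S, hS⟩ : ∃ S, ∀ k, |σ k| ≤ S :=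
    ⟨∑ k, |σ k|, fun k => Finset.single_le_sum (f := fun k => |σ k|)
      (fun i _ => abs_nonneg (σ i)) (Finset.mem_univ k)⟩
  have hS0 : 0 ≤ S := (abs_nonneg _).trans (hS 0)
  refine ⟨δ / 6, by positivity, 1 + 6 * S / δ, le_add_of_nonneg_right (by positivity), ?_⟩
  intro τ ξ hτ hξ h i j
  obtain ⟨m, hm⟩ := Finite.exists_max fun k => nrm2 (ξ k)
  have hn : ∀ k, 0 ≤ nrm2 (ξ k) := fun k => nrm2_nonneg _
  have t0 : nrm2 (ξ 0) ≤ nrm2 (ξ 1) + nrm2 (ξ 2) := nrm2_le_add_of_add_eq_zero hξ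
  have t1 : nrm2 (ξ 1) ≤ nrm2 (ξ 2) + nrm2 (ξ 0) :=
    nrm2_le_add_of_add_eq_zero (by rw [← hξ]; abel)
  have t2 : nrm2 (ξ 2) ≤ nrm2 (ξ 0) + nrm2 (ξ 1) :=
    nrm2_le_add_of_add_eq_zero (by rw [← hξ]; abel)
  have hmod : ∀ k, |τ k + σ k * nrm2 (ξ k) ^ 2| ≤ δ / 6 * nrm2 (ξ m) ^ 2 := fun k => by
    obtain ⟨l, hl⟩ := h k
    refine hl.trans (mul_le_mul_of_nonneg_left ?_ (by positivity))
    exact pow_le_pow_left₀ (hn l) (hm l) 2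
  have hres : |σ 0 * nrm2 (ξ 0) ^ 2 + σ 1 * nrm2 (ξ 1) ^ 2 + σ 2 * nrm2 (ξ 2) ^ 2|
      ≤ δ / 2 * nrm2 (ξ m) ^ 2 := by
    have h0 := abs_le.1 (hmod 0)
    have h1 := abs_le.1 (hmod 1)
    have h2 := abs_le.1 (hmod 2)
    rw [abs_le]
    constructor <;> linarith
  suffices hmj : nrm2 (ξ m) ≤ (1 + 6 * S / δ) * nrm2 (ξ j) from (hm i).trans hmj
  have of_ne : δ * nrm2 (ξ m) ≤ 6 * S * nrm2 (ξ j) →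
      nrm2 (ξ m) ≤ (1 + 6 * S / δ) * nrm2 (ξ j) := fun hle => by
    have : nrm2 (ξ m) ≤ 6 * S / δ * nrm2 (ξ j) := by
      rw [div_mul_eq_mul_div, le_div_iff₀ hδ]
      linarith
    linarith [hn j]
  have key : ∀ k, σ 0 * nrm2 (ξ 0) ^ 2 + σ 1 * nrm2 (ξ 1) ^ 2 + σ 2 * nrm2 (ξ 2) ^ 2 =
        σ m * nrm2 (ξ m) ^ 2 + σ k * nrm2 (ξ k) ^ 2 + σ j * nrm2 (ξ j) ^ 2 →
      nrm2 (ξ m) ≤ nrm2 (ξ k) + nrm2 (ξ j) → δ ≤ |σ m + σ k| →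
      nrm2 (ξ m) ≤ (1 + 6 * S / δ) * nrm2 (ξ j) := fun k hsum htri hmk =>
    of_ne (mul_largest_side_le (hn k) (hn j) (hm k) (hm j) htri hmk (hS k) (hS j)
      (hsum ▸ hres))
  by_cases hmj : m = j
  · rw [hmj]
    exact le_mul_of_one_le_left (hn j) (le_add_of_nonneg_right (by positivity))
  have hδ10 := add_comm (σ 0) (σ 1) ▸ hδ01
  have hδ21 := add_comm (σ 1) (σ 2) ▸ hδ12
  have hδ02 := add_comm (σ 2) (σ 0) ▸ hδ20
  clear hm hres of_ne hmod
  fin_cases m <;> fin_cases j <;> first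
    | exact absurd rfl hmj
    | (refine key 0 ?_ ?_ ?_ <;> dsimp <;> linarith)
    | (refine key 1 ?_ ?_ ?_ <;> dsimp <;> linarith)
    | (refine key 2 ?_ ?_ ?_ <;> dsimp <;> linarith)
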